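/- arXiv:2401.03508 — 7 statements merged into one kernel-verified Lean document; each statement's English description precedes it below -/
import Mathlib

section
/- Let k ∈ ℂ^n be a unit vector, 0 < b ≤ 1/4, and λ = (1 − √(1−4b))/2. Set ψ₁ = √(1−λ)(k⊗e₁) − √λ(k⊗e₀), ψ₂ = k⊗e₁, ψ₃ = √(1−λ)(k⊗e₁) + √λ(k⊗e₀) in ℂ^n⊗ℂ². Then ψ₁, ψ₂, ψ₃ are unit vectors and (|k⟩⟨k|⊗|0⟩⟨0|) |ψ₃⟩⟨ψ₃| |ψ₂⟩⟨ψ₂| |ψ₁⟩⟨ψ₁| (|k⟩⟨k|⊗|0⟩⟨0|) = −b (|k⟩⟨k|⊗|0⟩⟨0|). -/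
open Matrix Kronecker

/-- The outer product `|u⟩⟨v| = u vᴴ`. -/
def outer {n : Type*} [Fintype n] (u v : n → ℂ) : Matrix n n ℂ :=
  Matrix.vecMulVec u (star v)

/-- The Kronecker (tensor) product of vectors, `(u ⊗ v) (i,j) = u i * v j`. -/
def tensorVec {n : ℕ} (u : Fin n → ℂ) (v : Fin 2 → ℂ) : Fin n × Fin 2 → ℂ :=
  fun p => u p.1 * v p.2

/-- The standard basis vector `e₀` of ℂ². -/
def e₀ : Fin 2 → ℂ := ![1, 0]

/-- The standard basis vector `e₁` of ℂ². -/
def e₁ : Fin 2 → ℂ := ![0, 1]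

lemma outer_mul_outer' {m : Type*} [Fintype m] (u v w z : m → ℂ) :
    outer u v * outer w z = (star v ⬝ᵥ w) • outer u z := by
  unfold outer
  rw [Matrix.vecMulVec_mul_vecMulVec]
  ext i j
  simp [Matrix.vecMulVec_apply]
  try ring

lemma tensorVec_dot {n : ℕ} (u w : Fin n → ℂ) (v z : Fin 2 → ℂ) :
    star (tensorVec u v) ⬝ᵥ tensorVec w z = (star u ⬝ᵥ w) * (star v ⬝ᵥ z) := by
  simp only [dotProduct, tensorVec, Fintype.sum_prod_type, Finset.sum_mul_sum, Pi.star_apply,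
    star_mul']
  refine Finset.sum_congr rfl fun i _ => Finset.sum_congr rfl fun j _ => ?_
  ring

lemma kron_outer {n : ℕ} (u w : Fin n → ℂ) (v z : Fin 2 → ℂ) :
    outer u w ⊗ₖ outer v z = outer (tensorVec u v) (tensorVec w z) := by
  ext ⟨i, j⟩ ⟨i', j'⟩
  simp [outer, Matrix.vecMulVec_apply, tensorVec, Matrix.kroneckerMap_apply]
  ring

/-- for a unit vector `k`, `0 < b ≤ 1/4` and `λ = (1 − √(1−4b))/2`, the
vectors `ψ₁ = √(1−λ)(k⊗e₁) − √λ(k⊗e₀)`, `ψ₂ = k⊗e₁`, `ψ₃ = √(1−λ)(k⊗e₁) + √λ(k⊗e₀)` are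
unit vectors and
`(|k⟩⟨k|⊗|0⟩⟨0|) |ψ₃⟩⟨ψ₃| |ψ₂⟩⟨ψ₂| |ψ₁⟩⟨ψ₁| (|k⟩⟨k|⊗|0⟩⟨0|) = −b (|k⟩⟨k|⊗|0⟩⟨0|)`. -/
theorem negative_part_projector_product
    (n : ℕ) (k : Fin n → ℂ) (hk : star k ⬝ᵥ k = 1)
    (b lam : ℝ) (hb : 0 < b) (hb' : b ≤ 1 / 4)
    (hlam : lam = (1 - Real.sqrt (1 - 4 * b)) / 2)
    (ψ₁ ψ₂ ψ₃ : Fin n × Fin 2 → ℂ)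
    (hψ₁ : ψ₁ = (Real.sqrt (1 - lam) : ℂ) • tensorVec k e₁ - (Real.sqrt lam : ℂ) • tensorVec k e₀)
    (hψ₂ : ψ₂ = tensorVec k e₁)
    (hψ₃ : ψ₃ = (Real.sqrt (1 - lam) : ℂ) • tensorVec k e₁ + (Real.sqrt lam : ℂ) • tensorVec k e₀) :
    (star ψ₁ ⬝ᵥ ψ₁ = 1 ∧ star ψ₂ ⬝ᵥ ψ₂ = 1 ∧ star ψ₃ ⬝ᵥ ψ₃ = 1) ∧
      (outer k k ⊗ₖ outer e₀ e₀) * outer ψ₃ ψ₃ * outer ψ₂ ψ₂ * outer ψ₁ ψ₁ *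
          (outer k k ⊗ₖ outer e₀ e₀)
        = (-(b : ℂ)) • (outer k k ⊗ₖ outer e₀ e₀) := by
  have hs : Real.sqrt (1 - 4 * b) ^ 2 = 1 - 4 * b := Real.sq_sqrt (by linarith)
  have hs0 := Real.sqrt_nonneg (1 - 4 * b)
  have hs1 : Real.sqrt (1 - 4 * b) ≤ 1 := by
    exact Real.sqrt_le_one.mpr (by linarith)
  have h1 : Real.sqrt lam ^ 2 = lam := Real.sq_sqrt (by linarith)
  have h2 : Real.sqrt (1 - lam) ^ 2 = 1 - lam := Real.sq_sqrt (by linarith)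
  have hb2 : lam * (1 - lam) = b := by rw [hlam]; linear_combination (-1 / 4) * hs
  have h1c : ((Real.sqrt lam : ℝ) : ℂ) ^ 2 = lam := by exact_mod_cast h1
  have h2c : ((Real.sqrt (1 - lam) : ℝ) : ℂ) ^ 2 = 1 - lam := by exact_mod_cast h2
  have hbc : (lam : ℂ) * (1 - lam) = b := by exact_mod_cast hb2
  have hxx : star (tensorVec k e₀) ⬝ᵥ tensorVec k e₀ = 1 := by
    rw [tensorVec_dot, hk]; simp [e₀, dotProduct]
  have hyy : star (tensorVec k e₁) ⬝ᵥ tensorVec k e₁ = 1 := by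
    rw [tensorVec_dot, hk]; simp [e₁, dotProduct]
  have hxy : star (tensorVec k e₀) ⬝ᵥ tensorVec k e₁ = 0 := by
    rw [tensorVec_dot, hk]; simp [e₀, e₁, dotProduct]
  have hyx : star (tensorVec k e₁) ⬝ᵥ tensorVec k e₀ = 0 := by
    rw [tensorVec_dot, hk]; simp [e₀, e₁, dotProduct]
  rw [kron_outer]
  generalize tensorVec k e₀ = x at *
  generalize tensorVec k e₁ = y at *
  generalize Real.sqrt lam = s at *
  generalize Real.sqrt (1 - lam) = c at *
  subst hψ₁ hψ₂ hψ₃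
  refine ⟨⟨?_, hyy, ?_⟩, ?_⟩
  · simp [hxx, hyy, hxy, hyx]
    linear_combination h1c + h2c
  · simp [hxx, hyy, hxy, hyx]
    linear_combination h1c + h2c
  · simp only [outer_mul_outer', Matrix.smul_mul, smul_smul]
    congr 1
    simp [hxx, hyy, hxy, hyx]
    linear_combination (c : ℂ) ^ 2 * h1c + (lam : ℂ) * h2c + hbc
end

section
/- Let W be a Hermitian n×n complex matrix all of whose eigenvalues lie in the interval [−1/4, 1/4]. Then there exist projections Π₀, Π₁, Π₂, Π₃ on ℂ^n⊗ℂ² such that Π₀ Π₃ Π₂ Π₁ Π₀ = W ⊗ |0⟩⟨0|. -/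
open Matrix Kronecker

/-- A projection: Hermitian and idempotent. -/
def IsProjection {m : Type*} [Fintype m] [DecidableEq m] (P : Matrix m m ℂ) : Prop :=
  P.IsHermitian ∧ P * P = P

lemma aux_exists_block (n : ℕ) (W : Matrix (Fin n) (Fin n) ℂ) (hW : W.IsHermitian)
    (hspec : ∀ i, hW.eigenvalues i ∈ Set.Icc (-(1 / 4 : ℝ)) (1 / 4)) :
    ∃ A : Matrix (Fin n) (Fin n) ℂ, A.IsHermitian ∧ A * W = W * A ∧
      A * A + (4 : ℂ) • (W * W) = A := by
  let φ := Unitary.conjStarAlgAut ℂ _ hW.eigenvectorUnitary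
  let p : Fin n → ℂ := fun i => (((1 + Real.sqrt (1 - 16 * hW.eigenvalues i ^ 2)) / 2 : ℝ) : ℂ)
  let l : Fin n → ℂ := fun i => ((hW.eigenvalues i : ℝ) : ℂ)
  have hs : W = φ (diagonal l) := hW.spectral_theorem
  have hp : ∀ i, p i * p i + 4 * (l i * l i) = p i := by
    intro i
    obtain ⟨h1, h2⟩ := hspec i
    have h3 : 0 ≤ 1 - 16 * hW.eigenvalues i ^ 2 := by nlinarith
    have h4 := Real.mul_self_sqrt h3
    simp only [p, l]
    norm_cast
    nlinarith
  refine ⟨φ (diagonal p), ?_, ?_, ?_⟩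
  · have : star (φ (diagonal p)) = φ (diagonal p) := by
      rw [← map_star, star_eq_conjTranspose, diagonal_conjTranspose]
      congr 2
      ext i
      simp only [p, Pi.star_apply]
      exact Complex.conj_ofReal _
    exact this
  · rw [hs, ← map_mul, ← map_mul, diagonal_mul_diagonal, diagonal_mul_diagonal]
    simp only [mul_comm]
  · rw [hs, ← map_mul, ← map_mul, ← map_smul, ← map_add, diagonal_mul_diagonal,
      diagonal_mul_diagonal, ← diagonal_smul, diagonal_add]
    congr 2
    ext i
    simpa using hp i

/-- any Hermitian `W` with spectrum in `[−1/4, 1/4]` admits a decomposition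
`W ⊗ |0⟩⟨0| = Π₀ Π₃ Π₂ Π₁ Π₀` as an ordered product of projections on `ℂ^n ⊗ ℂ²`. -/
theorem witness_extension_is_product_of_projections
    (n : ℕ) (W : Matrix (Fin n) (Fin n) ℂ) (hW : W.IsHermitian)
    (hspec : ∀ i, hW.eigenvalues i ∈ Set.Icc (-(1 / 4 : ℝ)) (1 / 4)) :
    ∃ P₀ P₁ P₂ P₃ : Matrix (Fin n × Fin 2) (Fin n × Fin 2) ℂ,
      IsProjection P₀ ∧ IsProjection P₁ ∧ IsProjection P₂ ∧ IsProjection P₃ ∧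
        P₀ * P₃ * P₂ * P₁ * P₀ = W ⊗ₖ outer e₀ e₀ := by
  obtain ⟨A, hA, hAW, hAA⟩ := aux_exists_block n W hW hspec
  have he : outer e₀ e₀ = !![1, 0; 0, 0] := by
    ext i j
    fin_cases i <;> fin_cases j <;> simp [outer, e₀, vecMulVec_apply]
  have hproj : ∀ M : Matrix (Fin 2) (Fin 2) ℂ, Mᴴ = M → M * M = M →
      IsProjection ((1 : Matrix (Fin n) (Fin n) ℂ) ⊗ₖ M) := by
    intro M h1 h2
    refine ⟨?_, ?_⟩
    · rw [IsHermitian, conjTranspose_kronecker, h1, conjTranspose_one]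
    · rw [← mul_kronecker_mul, h2, one_mul]
  refine ⟨1 ⊗ₖ !![1, 0; 0, 0],
    A ⊗ₖ !![1, 0; 0, 0] + W ⊗ₖ !![0, 2; 2, 0] + (1 - A) ⊗ₖ !![0, 0; 0, 1],
    1 ⊗ₖ !![0, 0; 0, 1], 1 ⊗ₖ !![1 / 2, 1 / 2; 1 / 2, 1 / 2],
    hproj _ ?_ ?_, ⟨?_, ?_⟩, hproj _ ?_ ?_, hproj _ ?_ ?_, ?_⟩
  · ext i j; fin_cases i <;> fin_cases j <;> simp
  · ext i j; fin_cases i <;> fin_cases j <;> simp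
  · rw [IsHermitian, conjTranspose_add, conjTranspose_add, conjTranspose_kronecker,
      conjTranspose_kronecker, conjTranspose_kronecker, conjTranspose_sub, hA.eq, hW.eq,
      conjTranspose_one]
    have h1 : (!![1, 0; 0, 0] : Matrix (Fin 2) (Fin 2) ℂ)ᴴ = !![1, 0; 0, 0] := by
      ext i j; fin_cases i <;> fin_cases j <;> simp
    have h2 : (!![0, 2; 2, 0] : Matrix (Fin 2) (Fin 2) ℂ)ᴴ = !![0, 2; 2, 0] := by
      ext i j; fin_cases i <;> fin_cases j <;> simp
    have h3 : (!![0, 0; 0, 1] : Matrix (Fin 2) (Fin 2) ℂ)ᴴ = !![0, 0; 0, 1] := by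
      ext i j; fin_cases i <;> fin_cases j <;> simp
    rw [h1, h2, h3]
  · simp only [add_mul, mul_add, ← mul_kronecker_mul, sub_mul, mul_sub, one_mul, mul_one, hAW]
    ext ⟨i, a⟩ ⟨j, b⟩
    have h := congrFun (congrFun hAA i) j
    simp only [Matrix.add_apply, Matrix.smul_apply, smul_eq_mul] at h
    fin_cases a <;> fin_cases b <;> simp [kroneckerMap_apply] <;>
      first | linear_combination h | ring
  · ext i j; fin_cases i <;> fin_cases j <;> simp
  · ext i j; fin_cases i <;> fin_cases j <;> simp
  · ext i j; fin_cases i <;> fin_cases j <;> simp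
  · ext i j; fin_cases i <;> fin_cases j <;> norm_num [Matrix.mul_apply]
  · simp only [add_mul, mul_add, ← mul_kronecker_mul, one_mul, mul_one, he]
    ext ⟨i, a⟩ ⟨j, b⟩
    fin_cases a <;> fin_cases b <;> simp [kroneckerMap_apply]
end

section
/- Let C be a closed convex set of density matrices on ℂ^n and let ρ be a density matrix with ρ ∉ C. Then there exist projections Π₀, Π₁, Π₂, Π₃ acting on ℂ^n⊗ℂ² such that Tr[Π₀ Π₃ Π₂ Π₁ Π₀ (ρ⊗|0⟩⟨0|)] is a real number that is strictly negative, while for every σ ∈ C, Tr[Π₀ Π₃ Π₂ Π₁ Π₀ (σ⊗|0⟩⟨0|)] is a real number that is nonnegative. -/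
open Matrix Kronecker ComplexOrder

/-- A density matrix on ℂ^n: positive semidefinite with unit trace. -/
def IsDensityMatrix {n : ℕ} (ρ : Matrix (Fin n) (Fin n) ℂ) : Prop :=
  ρ.PosSemidef ∧ ρ.trace = 1

lemma aux_sep {n : ℕ} (C : Set (Matrix (Fin n) (Fin n) ℂ))
    (hC_density : ∀ σ ∈ C, IsDensityMatrix σ)
    (hC_closed : IsClosed C) (hC_convex : Convex ℝ C)
    (ρ : Matrix (Fin n) (Fin n) ℂ) (hρ : IsDensityMatrix ρ) (hρC : ρ ∉ C) :
    ∃ W : Matrix (Fin n) (Fin n) ℂ, W.IsHermitian ∧ (W * ρ).trace.re < 0 ∧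
      ∀ σ ∈ C, 0 ≤ (W * σ).trace.re := by
  have : LocallyConvexSpace ℝ (Matrix (Fin n) (Fin n) ℂ) :=
    inferInstanceAs (LocallyConvexSpace ℝ (Fin n → Fin n → ℂ))
  obtain ⟨f, u, h1, h2⟩ := geometric_hahn_banach_point_closed hC_convex hC_closed hρC
  let G : Matrix (Fin n) (Fin n) ℂ := Matrix.of fun j i =>
    ((f (Matrix.single i j 1) : ℝ) : ℂ) - Complex.I * ((f (Matrix.single i j Complex.I) : ℝ) : ℂ)
  have hG : ∀ σ : Matrix (Fin n) (Fin n) ℂ, (G * σ).trace.re = f σ := by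
    intro σ
    conv_rhs => rw [Matrix.matrix_eq_sum_single σ]
    have hs : ∀ i j, f (Matrix.single i j (σ i j)) =
        (σ i j).re * f (Matrix.single i j 1) + (σ i j).im * f (Matrix.single i j Complex.I) := by
      intro i j
      have : Matrix.single i j (σ i j) = (σ i j).re • Matrix.single i j (1:ℂ) +
          (σ i j).im • Matrix.single i j Complex.I := by
        rw [Matrix.smul_single, Matrix.smul_single, ← Matrix.single_add]
        congr 1
        simp
      rw [this, map_add, map_smul, map_smul]; rfl
    simp only [map_sum, hs]
    rw [Finset.sum_comm]
    simp only [Matrix.trace, Matrix.diag, Matrix.mul_apply, Complex.re_sum]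
    refine Finset.sum_congr rfl fun j _ => Finset.sum_congr rfl fun i _ => ?_
    simp [G]
    ring
  have key : ∀ σ, IsDensityMatrix σ →
      (((1/2 : ℂ) • (G + Gᴴ) - (u : ℂ) • (1 : Matrix (Fin n) (Fin n) ℂ)) * σ).trace.re
        = f σ - u := by
    intro σ hσ
    have h3 : (Gᴴ * σ).trace = star (G * σ).trace := by
      rw [← Matrix.trace_conjTranspose, Matrix.conjTranspose_mul, hσ.1.isHermitian.eq,
        Matrix.trace_mul_comm]
    rw [← hG σ, sub_mul, Matrix.smul_mul, Matrix.smul_mul, add_mul, Matrix.trace_sub,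
      Matrix.trace_smul, Matrix.trace_smul, Matrix.trace_add, h3, one_mul, hσ.2]
    simp
    ring
  refine ⟨(1/2 : ℂ) • (G + Gᴴ) - (u : ℂ) • 1, ?_, ?_, ?_⟩
  · simp [Matrix.IsHermitian, Matrix.conjTranspose_sub, Matrix.conjTranspose_smul, add_comm]
  · rw [key ρ hρ]; linarith
  · intro σ hσ
    rw [key σ (hC_density σ hσ)]; linarith [h2 σ hσ]

lemma aux_im {n : ℕ} {X σ : Matrix (Fin n) (Fin n) ℂ} (hX : X.IsHermitian)
    (hσ : σ.IsHermitian) : (X * σ).trace.im = 0 := by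
  have : star (X * σ).trace = (X * σ).trace := by
    rw [← Matrix.trace_conjTranspose, Matrix.conjTranspose_mul, hX.eq, hσ.eq,
        Matrix.trace_mul_comm]
  exact Complex.conj_eq_iff_im.mp this

lemma aux_sqrt {n : ℕ} (W : Matrix (Fin n) (Fin n) ℂ) (hW : W.IsHermitian) :
    ∃ c : ℝ, 0 < c ∧ ∃ Y : Matrix (Fin n) (Fin n) ℂ, Y.IsHermitian ∧
      ((c : ℂ) • W) * Y = Y * ((c : ℂ) • W) ∧
      ((c : ℂ) • W) * ((c : ℂ) • W) + Y * Y = 1 := by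
  obtain ⟨U, l, hU, hU', hWU⟩ : ∃ (U : Matrix (Fin n) (Fin n) ℂ) (l : Fin n → ℝ),
      Uᴴ * U = 1 ∧ U * Uᴴ = 1 ∧ W = U * diagonal (fun i => (l i : ℂ)) * Uᴴ := by
    refine ⟨hW.eigenvectorUnitary, hW.eigenvalues, ?_, ?_, ?_⟩
    · exact Unitary.coe_star_mul_self hW.eigenvectorUnitary
    · exact Unitary.coe_mul_star_self hW.eigenvectorUnitary
    · exact hW.spectral_theorem
  have hmul : ∀ A B : Matrix (Fin n) (Fin n) ℂ,
      (U * A * Uᴴ) * (U * B * Uᴴ) = U * (A * B) * Uᴴ := by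
    intro A B
    calc _ = U * A * (Uᴴ * U) * B * Uᴴ := by simp only [mul_assoc]
      _ = _ := by rw [hU]; simp only [mul_assoc, one_mul]
  have hpos : 0 < 1 + ∑ i, |l i| := by positivity
  set c : ℝ := (1 + ∑ i, |l i|)⁻¹ with hc
  have hcpos : 0 < c := inv_pos.mpr hpos
  have hcl : ∀ i, (c * l i) ^ 2 ≤ 1 := by
    intro i
    rw [sq_le_one_iff_abs_le_one, abs_mul, abs_of_pos hcpos, hc, inv_mul_le_one₀ hpos]
    have := Finset.single_le_sum (f := fun i => |l i|) (fun i _ => abs_nonneg _) (Finset.mem_univ i)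
    linarith
  have hcW : (c : ℂ) • W = U * diagonal (fun i => ((c * l i : ℝ) : ℂ)) * Uᴴ := by
    rw [hWU, ← Matrix.smul_mul, ← Matrix.mul_smul, ← Matrix.diagonal_smul]
    congr 3
    ext i; simp
  refine ⟨c, hcpos, U * diagonal (fun i => ((√(1 - (c * l i)^2) : ℝ) : ℂ)) * Uᴴ, ?_, ?_, ?_⟩
  · rw [Matrix.IsHermitian, Matrix.conjTranspose_mul, Matrix.conjTranspose_mul,
      Matrix.diagonal_conjTranspose, Matrix.conjTranspose_conjTranspose, ← mul_assoc]
    congr 3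
    ext i; simp
  · rw [hcW, hmul, hmul, Matrix.diagonal_mul_diagonal, Matrix.diagonal_mul_diagonal]
    simp only [mul_comm]
  · rw [hcW, hmul, hmul, Matrix.diagonal_mul_diagonal, Matrix.diagonal_mul_diagonal,
      ← add_mul, ← mul_add, Matrix.diagonal_add]
    have : (fun i => ((c * l i : ℝ) : ℂ) * ((c * l i : ℝ) : ℂ) +
        ((√(1 - (c * l i)^2) : ℝ) : ℂ) * ((√(1 - (c * l i)^2) : ℝ) : ℂ)) = fun _ => 1 := by
      ext i
      rw [← Complex.ofReal_mul, ← Complex.ofReal_mul, Real.mul_self_sqrt (by linarith [hcl i])]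
      norm_cast
      ring
    rw [this, Matrix.diagonal_one, mul_one, hU']

lemma aux_kron {n : ℕ} {Q : Matrix (Fin 2) (Fin 2) ℂ} (h : IsProjection Q) :
    IsProjection ((1 : Matrix (Fin n) (Fin n) ℂ) ⊗ₖ Q) := by
  refine ⟨?_, ?_⟩
  · rw [Matrix.IsHermitian, Matrix.conjTranspose_kronecker, h.1.eq, Matrix.conjTranspose_one]
  · rw [← Matrix.mul_kronecker_mul, h.2, one_mul]

lemma aux_P2 {n : ℕ} {X Y : Matrix (Fin n) (Fin n) ℂ} (hX : X.IsHermitian) (hY : Y.IsHermitian)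
    (hXY : X * Y = Y * X) (h1 : X * X + Y * Y = 1) :
    IsProjection ((1/2 : ℂ) • ((1 : Matrix (Fin n) (Fin n) ℂ) ⊗ₖ (1 : Matrix (Fin 2) (Fin 2) ℂ)
      + X ⊗ₖ !![(1:ℂ), 0; 0, -1] + Y ⊗ₖ !![(0:ℂ), 1; 1, 0])) := by
  have z1 : (!![(1:ℂ), 0; 0, -1])ᴴ = !![(1:ℂ), 0; 0, -1] := by
    ext i j; fin_cases i <;> fin_cases j <;> simp
  have z2 : (!![(0:ℂ), 1; 1, 0])ᴴ = !![(0:ℂ), 1; 1, 0] := by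
    ext i j; fin_cases i <;> fin_cases j <;> simp
  have z3 : !![(1:ℂ), 0; 0, -1] * !![(1:ℂ), 0; 0, -1] = 1 := by
    ext i j; fin_cases i <;> fin_cases j <;> simp
  have z4 : !![(0:ℂ), 1; 1, 0] * !![(0:ℂ), 1; 1, 0] = 1 := by
    ext i j; fin_cases i <;> fin_cases j <;> simp
  have z5 : !![(0:ℂ), 1; 1, 0] * !![(1:ℂ), 0; 0, -1]
      = -(!![(1:ℂ), 0; 0, -1] * !![(0:ℂ), 1; 1, 0]) := by
    ext i j; fin_cases i <;> fin_cases j <;> simp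
  generalize !![(1:ℂ), 0; 0, -1] = Z at *
  generalize !![(0:ℂ), 1; 1, 0] = V at *
  refine ⟨?_, ?_⟩
  · simp [Matrix.IsHermitian, Matrix.conjTranspose_smul, Matrix.conjTranspose_kronecker,
      z1, z2, hX.eq, hY.eq]
  · have h2 : (X * X) ⊗ₖ (1 : Matrix (Fin 2) (Fin 2) ℂ) + (Y * Y) ⊗ₖ 1 = 1 := by
      rw [← Matrix.add_kronecker, h1, Matrix.one_kronecker_one]
    have h3 : (Y * X) ⊗ₖ (-(Z * V)) = - ((Y * X) ⊗ₖ (Z * V)) := by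
      rw [← neg_one_smul ℂ (Z * V), Matrix.kronecker_smul, neg_one_smul]
    rw [Matrix.smul_mul, Matrix.mul_smul, smul_smul]
    simp only [mul_add, add_mul, ← Matrix.mul_kronecker_mul, one_mul, mul_one, z3, z4, z5, h3, hXY]
    rw [Matrix.one_kronecker_one]
    rw [← eq_sub_iff_add_eq] at h2
    rw [h2]
    module

/-- Theorem 1 of the paper: for any closed convex set `C` of density
matrices and any density matrix `ρ ∉ C` there are projections `Π₀, Π₁, Π₂, Π₃` on
`ℂ^n ⊗ ℂ²` such that the Kirkwood–Dirac type quasiprobability outcome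
`Tr[Π₀ Π₃ Π₂ Π₁ Π₀ (ρ⊗|0⟩⟨0|)]` is real and strictly negative, while
`Tr[Π₀ Π₃ Π₂ Π₁ Π₀ (σ⊗|0⟩⟨0|)]` is real and nonnegative for every `σ ∈ C`. -/
theorem negative_quasiprobability_reveals_resource
    (n : ℕ) (C : Set (Matrix (Fin n) (Fin n) ℂ))
    (hC_density : ∀ σ ∈ C, IsDensityMatrix σ)
    (hC_closed : IsClosed C) (hC_convex : Convex ℝ C)
    (ρ : Matrix (Fin n) (Fin n) ℂ) (hρ : IsDensityMatrix ρ) (hρC : ρ ∉ C) :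
    ∃ P₀ P₁ P₂ P₃ : Matrix (Fin n × Fin 2) (Fin n × Fin 2) ℂ,
      IsProjection P₀ ∧ IsProjection P₁ ∧ IsProjection P₂ ∧ IsProjection P₃ ∧
      ((P₀ * P₃ * P₂ * P₁ * P₀ * (ρ ⊗ₖ outer e₀ e₀)).trace.im = 0 ∧
        (P₀ * P₃ * P₂ * P₁ * P₀ * (ρ ⊗ₖ outer e₀ e₀)).trace.re < 0) ∧
      (∀ σ ∈ C, (P₀ * P₃ * P₂ * P₁ * P₀ * (σ ⊗ₖ outer e₀ e₀)).trace.im = 0 ∧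
        0 ≤ (P₀ * P₃ * P₂ * P₁ * P₀ * (σ ⊗ₖ outer e₀ e₀)).trace.re) := by
  obtain ⟨W, hW, hW1, hW2⟩ := aux_sep C hC_density hC_closed hC_convex ρ hρ hρC
  obtain ⟨c, hc, Y, hY, hXY, h1⟩ := aux_sqrt W hW
  have hX : ((c : ℂ) • W).IsHermitian := by
    simp [Matrix.IsHermitian, Matrix.conjTranspose_smul, hW.eq]
  have key : ∀ σ : Matrix (Fin n) (Fin n) ℂ,
      (((1 : Matrix (Fin n) (Fin n) ℂ) ⊗ₖ !![(1:ℂ), 0; 0, 0]) *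
        ((1 : Matrix (Fin n) (Fin n) ℂ) ⊗ₖ !![(1/2:ℂ), -1/2; -1/2, 1/2]) *
        ((1/2 : ℂ) • ((1 : Matrix (Fin n) (Fin n) ℂ) ⊗ₖ (1 : Matrix (Fin 2) (Fin 2) ℂ)
          + ((c : ℂ) • W) ⊗ₖ !![(1:ℂ), 0; 0, -1] + Y ⊗ₖ !![(0:ℂ), 1; 1, 0])) *
        ((1 : Matrix (Fin n) (Fin n) ℂ) ⊗ₖ !![(1/2:ℂ), 1/2; 1/2, 1/2]) *
        ((1 : Matrix (Fin n) (Fin n) ℂ) ⊗ₖ !![(1:ℂ), 0; 0, 0]) *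
        (σ ⊗ₖ outer e₀ e₀)).trace = ((c / 4 : ℝ) : ℂ) * (W * σ).trace := by
    intro σ
    have ho : outer e₀ e₀ = !![(1:ℂ), 0; 0, 0] := by
      ext i j; fin_cases i <;> fin_cases j <;> simp [outer, e₀, Matrix.vecMulVec_apply]
    rw [ho]
    simp only [Matrix.smul_mul, Matrix.mul_smul, mul_add, add_mul, ← Matrix.mul_kronecker_mul,
      one_mul, mul_one, Matrix.trace_smul, Matrix.trace_add, Matrix.trace_kronecker]
    simp [Matrix.trace_fin_two]
    ring
  refine ⟨_, _, _, _, aux_kron (Q := !![(1:ℂ), 0; 0, 0]) ?_,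
    aux_kron (Q := !![(1/2:ℂ), 1/2; 1/2, 1/2]) ?_, aux_P2 hX hY hXY h1,
    aux_kron (Q := !![(1/2:ℂ), -1/2; -1/2, 1/2]) ?_, ?_, ?_⟩
  · constructor <;> ext i j <;> fin_cases i <;> fin_cases j <;> simp
  · constructor <;> ext i j <;> fin_cases i <;> fin_cases j <;> simp <;> norm_num
  · constructor <;> ext i j <;> fin_cases i <;> fin_cases j <;> simp <;> norm_num
  · rw [key ρ, Complex.im_ofReal_mul, Complex.re_ofReal_mul, aux_im hW hρ.1.isHermitian]
    exact ⟨mul_zero _, mul_neg_of_pos_of_neg (by positivity) hW1⟩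
  · intro σ hσ
    rw [key σ, Complex.im_ofReal_mul, Complex.re_ofReal_mul,
      aux_im hW (hC_density σ hσ).1.isHermitian]
    exact ⟨mul_zero _, mul_nonneg (by positivity) (hW2 σ hσ)⟩
end

section
/- Let C be a nonempty compact convex set of density matrices on ℂ^n and let ρ be a density matrix with ρ ∉ C. Then there exist projections Π₀, Π₁, Π₂, Π₃ on ℂ^n⊗ℂ² and a constant c > 0 such that Tr[Π₀ Π₃ Π₂ Π₁ Π₀ (ρ⊗|0⟩⟨0|)] = −c · min_{σ∈C} ‖ρ − σ‖_F, and for every σ ∈ C the number Tr[Π₀ Π₃ Π₂ Π₁ Π₀ (σ⊗|0⟩⟨0|)] is real and nonnegative. In other words, the total negativity of the associated quasiprobability distribution is directly proportional to the Frobenius distance from ρ to the closest classical state. -/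
open Matrix Kronecker ComplexOrder

/-- The Frobenius norm `‖A‖_F = √Tr(AᴴA)` of a complex matrix. -/
noncomputable def frobNorm {n : ℕ} (A : Matrix (Fin n) (Fin n) ℂ) : ℝ :=
  Real.sqrt ((Aᴴ * A).trace.re)

/-- The first-order optimality step for quadratic functions. -/
lemma quad_aux (a b : ℝ) (h : ∀ s : ℝ, 0 < s → s ≤ 1 → 0 ≤ 2 * s * a + s ^ 2 * b) : 0 ≤ a := by
  by_contra hneg
  push Not at hneg
  have hb : 0 < |b| - a + 1 := by linarith [abs_nonneg b]
  have hs : 0 < -a / (|b| - a + 1) := div_pos (by linarith) hb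
  have hs1 : -a / (|b| - a + 1) ≤ 1 := by
    rw [div_le_one hb]; linarith [abs_nonneg b]
  have h1 := h _ hs hs1
  set s := -a / (|b| - a + 1) with hsdef
  have hsm : s * (|b| - a + 1) = -a := by rw [hsdef]; field_simp
  have h2 : 0 ≤ 2 * a + s * b := by
    by_contra h3
    push Not at h3
    nlinarith
  have h4 : s * b ≤ s * |b| := mul_le_mul_of_nonneg_left (le_abs_self b) hs.le
  nlinarith

lemma trace_herm_im {m : Type*} [Fintype m] {A B : Matrix m m ℂ} (hA : A.IsHermitian)
    (hB : B.IsHermitian) : (A * B).trace.im = 0 := by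
  have h : star (A * B).trace = (A * B).trace := by
    rw [← trace_conjTranspose, conjTranspose_mul, hA.eq, hB.eq, trace_mul_comm]
  exact Complex.conj_eq_iff_im.mp h

/-- A Hermitian matrix can be scaled so that it is a contraction, with a commuting square root
of the defect. -/
lemma exists_scale {n : ℕ} {H : Matrix (Fin n) (Fin n) ℂ} (hH : H.IsHermitian) :
    ∃ (t : ℝ) (B : Matrix (Fin n) (Fin n) ℂ), 0 < t ∧ B.IsHermitian ∧
      ((t : ℂ) • H) * B = B * ((t : ℂ) • H) ∧
      ((t : ℂ) • H) * ((t : ℂ) • H) + B * B = 1 := by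
  classical
  set d := hH.eigenvalues with hd
  set t : ℝ := 1 / (1 + ∑ i, |d i|) with ht
  have hS : 0 < 1 + ∑ i, |d i| := by positivity
  have htpos : 0 < t := by positivity
  have hle : ∀ i, (t * d i) ^ 2 ≤ 1 := by
    intro i
    rw [sq_le_one_iff_abs_le_one, abs_mul, abs_of_pos htpos, ht, one_div, inv_mul_le_iff₀ hS]
    have := Finset.single_le_sum (f := fun i => |d i|) (fun i _ => abs_nonneg _) (Finset.mem_univ i)
    linarith
  set U : Matrix (Fin n) (Fin n) ℂ := (hH.eigenvectorUnitary : Matrix (Fin n) (Fin n) ℂ) with hU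
  have hUU : Uᴴ * U = 1 := by
    have := (Matrix.mem_unitaryGroup_iff').mp hH.eigenvectorUnitary.2
    exact this
  have hUU' : U * Uᴴ = 1 := by
    have := (Matrix.mem_unitaryGroup_iff).mp hH.eigenvectorUnitary.2
    exact this
  have hspec : H = U * diagonal (fun i => (d i : ℂ)) * Uᴴ := by
    have := hH.spectral_theorem
    rw [Unitary.conjStarAlgAut_apply] at this
    exact this
  have hX : (t : ℂ) • H = U * diagonal (fun i => ((t * d i : ℝ) : ℂ)) * Uᴴ := by
    conv_lhs => rw [hspec]
    rw [← Matrix.smul_mul, ← Matrix.mul_smul]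
    congr 2
    ext i j
    by_cases hij : i = j
    · subst hij; simp
    · simp [hij]
  have hconj : ∀ D E : Matrix (Fin n) (Fin n) ℂ,
      (U * D * Uᴴ) * (U * E * Uᴴ) = U * (D * E) * Uᴴ := by
    intro D E
    calc (U * D * Uᴴ) * (U * E * Uᴴ) = U * D * (Uᴴ * U) * E * Uᴴ := by simp only [Matrix.mul_assoc]
      _ = _ := by rw [hUU]; simp only [Matrix.mul_assoc, Matrix.one_mul]
  refine ⟨t, U * diagonal (fun i => ((Real.sqrt (1 - (t * d i) ^ 2) : ℝ) : ℂ)) * Uᴴ, htpos,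
    ?_, ?_, ?_⟩
  · apply Matrix.isHermitian_mul_mul_conjTranspose
    rw [Matrix.isHermitian_diagonal_iff]
    intro i
    simp [isSelfAdjoint_iff]
  · rw [hX, hconj, hconj, diagonal_mul_diagonal, diagonal_mul_diagonal]
    congr 3
    ext i
    ring
  · rw [hX, hconj, hconj, ← Matrix.add_mul, ← Matrix.mul_add, diagonal_mul_diagonal,
      diagonal_mul_diagonal, diagonal_add]
    have : (fun i => ((t * d i : ℝ) : ℂ) * ((t * d i : ℝ) : ℂ) +
        ((Real.sqrt (1 - (t * d i) ^ 2) : ℝ) : ℂ) * ((Real.sqrt (1 - (t * d i) ^ 2) : ℝ) : ℂ))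
        = fun _ => (1 : ℂ) := by
      ext i
      rw [← Complex.ofReal_mul, ← Complex.ofReal_mul, ← Complex.ofReal_add,
        Real.mul_self_sqrt (by linarith [hle i])]
      norm_cast
      ring
    rw [this, diagonal_one, Matrix.mul_one, hUU']

lemma exists_projections {n : ℕ} {X B : Matrix (Fin n) (Fin n) ℂ} (hX : X.IsHermitian)
    (hB : B.IsHermitian) (hc : X * B = B * X) (h1 : X * X + B * B = 1) :
    ∃ (P₀ P₁ P₂ P₃ : Matrix (Fin n × Fin 2) (Fin n × Fin 2) ℂ),
      IsProjection P₀ ∧ IsProjection P₁ ∧ IsProjection P₂ ∧ IsProjection P₃ ∧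
      ∀ σ : Matrix (Fin n) (Fin n) ℂ,
        (P₀ * P₃ * P₂ * P₁ * P₀ * (σ ⊗ₖ outer e₀ e₀)).trace = (1 / 4 : ℂ) * (X * σ).trace := by
  have hkron : ∀ p : Matrix (Fin 2) (Fin 2) ℂ, pᴴ = p → p * p = p →
      IsProjection ((1 : Matrix (Fin n) (Fin n) ℂ) ⊗ₖ p) := by
    intro p hp hpp
    refine ⟨?_, ?_⟩
    · unfold Matrix.IsHermitian
      rw [conjTranspose_kronecker, hp, conjTranspose_one]
    · rw [← mul_kronecker_mul, hpp, Matrix.one_mul]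
  have he : outer e₀ e₀ = !![1, 0; 0, 0] := by
    ext i j
    fin_cases i <;> fin_cases j <;> simp [outer, e₀, vecMulVec]
  set Z : Matrix (Fin 2) (Fin 2) ℂ := !![1, 0; 0, -1] with hZ
  set Y : Matrix (Fin 2) (Fin 2) ℂ := !![0, 1; 1, 0] with hY
  set p0 : Matrix (Fin 2) (Fin 2) ℂ := !![1, 0; 0, 0] with hp0
  set pp : Matrix (Fin 2) (Fin 2) ℂ := !![1/2, 1/2; 1/2, 1/2] with hpp
  set pm : Matrix (Fin 2) (Fin 2) ℂ := !![1/2, -1/2; -1/2, 1/2] with hpm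
  have hZh : Zᴴ = Z := by ext i j; fin_cases i <;> fin_cases j <;> simp [hZ]
  have hYh : Yᴴ = Y := by ext i j; fin_cases i <;> fin_cases j <;> simp [hY]
  have hZZ : Z * Z = 1 := by ext i j; fin_cases i <;> fin_cases j <;> simp [hZ]
  have hYY : Y * Y = 1 := by ext i j; fin_cases i <;> fin_cases j <;> simp [hY]
  have hZY : Z * Y = - (Y * Z) := by
    ext i j; fin_cases i <;> fin_cases j <;> simp [hY, hZ]
  have hsq : (X ⊗ₖ Z + B ⊗ₖ Y) * (X ⊗ₖ Z + B ⊗ₖ Y) = 1 := by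
    rw [Matrix.add_mul, Matrix.mul_add, Matrix.mul_add, ← mul_kronecker_mul, ← mul_kronecker_mul,
      ← mul_kronecker_mul, ← mul_kronecker_mul, hZZ, hYY, hZY, hc]
    have : (B * X) ⊗ₖ (-(Y * Z)) = - ((B * X) ⊗ₖ (Y * Z)) := by
      ext i j; simp [kronecker_apply]
    rw [this]
    calc _ = (X * X) ⊗ₖ (1 : Matrix (Fin 2) (Fin 2) ℂ) + (B * B) ⊗ₖ 1 := by abel
      _ = _ := by rw [← add_kronecker, h1, one_kronecker_one]
  refine ⟨1 ⊗ₖ p0, 1 ⊗ₖ pp, (1 / 2 : ℂ) • (1 + (X ⊗ₖ Z + B ⊗ₖ Y)), 1 ⊗ₖ pm, ?_, ?_, ?_, ?_, ?_⟩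
  · apply hkron
    · ext i j; fin_cases i <;> fin_cases j <;> simp [hp0]
    · ext i j; fin_cases i <;> fin_cases j <;> simp [hp0]
  · apply hkron
    · ext i j; fin_cases i <;> fin_cases j <;> simp [hpp]
    · ext i j; fin_cases i <;> fin_cases j <;> simp [hpp] <;> norm_num
  · refine ⟨?_, ?_⟩
    · unfold Matrix.IsHermitian
      rw [conjTranspose_smul, conjTranspose_add, conjTranspose_add, conjTranspose_kronecker,
        conjTranspose_kronecker, hX.eq, hB.eq, hZh, hYh, conjTranspose_one]
      simp
    · generalize X ⊗ₖ Z + B ⊗ₖ Y = V at hsq ⊢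
      rw [Matrix.smul_mul, Matrix.mul_smul, Matrix.add_mul, Matrix.mul_add, Matrix.mul_add, hsq,
        Matrix.one_mul, Matrix.one_mul, Matrix.mul_one, smul_smul]
      module
  · apply hkron
    · ext i j; fin_cases i <;> fin_cases j <;> simp [hpm]
    · ext i j; fin_cases i <;> fin_cases j <;> simp [hpm] <;> norm_num
  · intro σ
    rw [he, ← one_kronecker_one (α := ℂ) (m := Fin n) (n := Fin 2)]
    simp only [Matrix.mul_smul, Matrix.smul_mul, Matrix.mul_add, Matrix.add_mul,
      ← mul_kronecker_mul, Matrix.one_mul, Matrix.mul_one, trace_smul, trace_add, trace_kronecker]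
    have e1 : (p0 * pm * pp * p0 * p0).trace = 0 := by
      simp [hp0, hpm, hpp, Matrix.trace_fin_two]; norm_num
    have e2 : (p0 * pm * Z * pp * p0 * p0).trace = 1 / 2 := by
      simp [hp0, hpm, hpp, hZ, Matrix.trace_fin_two]; norm_num
    have e3 : (p0 * pm * Y * pp * p0 * p0).trace = 0 := by
      simp [hp0, hpm, hpp, hY, Matrix.trace_fin_two]; norm_num
    rw [e1, e2, e3]
    simp only [smul_eq_mul]
    ring

lemma density_herm {n : ℕ} {ρ : Matrix (Fin n) (Fin n) ℂ} (h : IsDensityMatrix ρ) :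
    ρ.IsHermitian := h.1.1

/-- Corollary 1 of the paper, geometric interpretation: for a nonempty
compact convex set `C` of density matrices and a density matrix `ρ ∉ C`, there exist
projections `Π₀, Π₁, Π₂, Π₃` on `ℂ^n ⊗ ℂ²` and `c > 0` such that the all-zeros
quasiprobability outcome equals `−c · min_{σ∈C} ‖ρ − σ‖_F`, while it is real and
nonnegative on every `σ ∈ C`. -/
theorem negativity_equals_frobenius_distance
    (n : ℕ) (C : Set (Matrix (Fin n) (Fin n) ℂ))
    (hC_density : ∀ σ ∈ C, IsDensityMatrix σ)
    (hC_nonempty : C.Nonempty) (hC_compact : IsCompact C) (hC_convex : Convex ℝ C)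
    (ρ : Matrix (Fin n) (Fin n) ℂ) (hρ : IsDensityMatrix ρ) (hρC : ρ ∉ C) :
    ∃ (P₀ P₁ P₂ P₃ : Matrix (Fin n × Fin 2) (Fin n × Fin 2) ℂ) (c : ℝ),
      IsProjection P₀ ∧ IsProjection P₁ ∧ IsProjection P₂ ∧ IsProjection P₃ ∧ 0 < c ∧
      (P₀ * P₃ * P₂ * P₁ * P₀ * (ρ ⊗ₖ outer e₀ e₀)).trace
        = -((c * sInf ((fun σ => frobNorm (ρ - σ)) '' C) : ℝ) : ℂ) ∧
      (∀ σ ∈ C, (P₀ * P₃ * P₂ * P₁ * P₀ * (σ ⊗ₖ outer e₀ e₀)).trace.im = 0 ∧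
        0 ≤ (P₀ * P₃ * P₂ * P₁ * P₀ * (σ ⊗ₖ outer e₀ e₀)).trace.re) := by
  classical
  have hcont : Continuous (fun σ : Matrix (Fin n) (Fin n) ℂ => frobNorm (ρ - σ)) := by
    unfold frobNorm
    fun_prop
  obtain ⟨σ₀, hσ₀, hmin⟩ := hC_compact.exists_isMinOn hC_nonempty hcont.continuousOn
  have hmin' : ∀ σ ∈ C, frobNorm (ρ - σ₀) ≤ frobNorm (ρ - σ) := fun σ hσ => hmin hσ
  have hInf : sInf ((fun σ => frobNorm (ρ - σ)) '' C) = frobNorm (ρ - σ₀) := by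
    apply IsLeast.csInf_eq
    refine ⟨⟨σ₀, hσ₀, rfl⟩, ?_⟩
    rintro _ ⟨σ, hσ, rfl⟩
    exact hmin' σ hσ
  have hρh := density_herm hρ
  have hσ₀h := density_herm (hC_density σ₀ hσ₀)
  set W := σ₀ - ρ with hW
  have hWh : W.IsHermitian := hσ₀h.sub hρh
  have hnn : ∀ A : Matrix (Fin n) (Fin n) ℂ, 0 ≤ (Aᴴ * A).trace.re := fun A =>
    (Complex.le_def.mp (posSemidef_conjTranspose_mul_self A).trace_nonneg).1
  -- variational inequality
  have hvar : ∀ σ ∈ C, 0 ≤ (W * (σ - σ₀)).trace.re := by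
    intro σ hσ
    have hσh := density_herm (hC_density σ hσ)
    apply quad_aux _ ((σ - σ₀) * (σ - σ₀)).trace.re
    intro s hs hs1
    have hmem : σ₀ + s • (σ - σ₀) ∈ C :=
      hC_convex.add_smul_sub_mem hσ₀ hσ ⟨hs.le, hs1⟩
    have h := hmin' _ hmem
    unfold frobNorm at h
    rw [Real.sqrt_le_sqrt_iff (hnn _)] at h
    have e1 : ρ - σ₀ = -W := by rw [hW]; abel
    have e2 : ρ - (σ₀ + s • (σ - σ₀)) = -(W + s • (σ - σ₀)) := by rw [hW]; abel
    have hD : (σ - σ₀)ᴴ = σ - σ₀ := (hσh.sub hσ₀h).eq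
    rw [e2, e1, conjTranspose_neg, conjTranspose_neg, conjTranspose_add, conjTranspose_smul, hD,
      hWh.eq, neg_mul_neg, neg_mul_neg] at h
    simp only [star_trivial, Matrix.add_mul, Matrix.mul_add, Matrix.smul_mul, Matrix.mul_smul,
      trace_add, trace_smul, Complex.add_re, Complex.real_smul, Complex.re_ofReal_mul] at h
    rw [trace_mul_comm (σ - σ₀) W] at h
    nlinarith
  have hWne : W ≠ 0 := by
    intro h0
    apply hρC
    rw [hW, sub_eq_zero] at h0
    rwa [← h0]
  have hfrob : frobNorm (ρ - σ₀) = Real.sqrt ((W * W).trace.re) := by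
    unfold frobNorm
    have e1 : ρ - σ₀ = -W := by rw [hW]; abel
    rw [e1, conjTranspose_neg, hWh.eq, neg_mul_neg]
  have hWnn : 0 ≤ (W * W).trace.re := by
    have := hnn W
    rwa [hWh.eq] at this
  have hWpos : 0 < (W * W).trace.re := by
    refine lt_of_le_of_ne hWnn fun h0 => hWne ?_
    apply trace_conjTranspose_mul_self_eq_zero_iff.mp
    rw [hWh.eq]
    exact Complex.ext h0.symm (trace_herm_im hWh hWh)
  -- the witness
  set k : ℝ := (W * σ₀).trace.re with hk
  have hkc : (W * σ₀).trace = (k : ℂ) := Complex.ext (by simp [hk])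
    (by simpa using trace_herm_im hWh hσ₀h)
  set H : Matrix (Fin n) (Fin n) ℂ := W - (k : ℂ) • 1 with hHdef
  have hHh : H.IsHermitian := by
    apply hWh.sub
    unfold Matrix.IsHermitian
    rw [conjTranspose_smul, conjTranspose_one]
    simp
  have hHtr : ∀ σ, IsDensityMatrix σ → (H * σ).trace = (W * (σ - σ₀)).trace := by
    intro σ hσ
    rw [hHdef, Matrix.sub_mul, Matrix.mul_sub, trace_sub, trace_sub, Matrix.smul_mul, trace_smul,
      Matrix.one_mul, hσ.2, hkc]
    simp
  obtain ⟨t, B, ht, hB, hcomm, hsq⟩ := exists_scale hHh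
  have hXh : ((t : ℂ) • H).IsHermitian := by
    unfold Matrix.IsHermitian
    rw [conjTranspose_smul, hHh.eq]
    simp
  obtain ⟨P₀, P₁, P₂, P₃, h0, h1, h2, h3, htr⟩ := exists_projections hXh hB hcomm hsq
  refine ⟨P₀, P₁, P₂, P₃, t / 4 * frobNorm (ρ - σ₀), h0, h1, h2, h3, ?_, ?_, ?_⟩
  · rw [hfrob]
    have := Real.sqrt_pos.mpr hWpos
    positivity
  · rw [htr, hInf, mul_assoc, hfrob, Real.mul_self_sqrt hWnn, Matrix.smul_mul, trace_smul,
      hHtr ρ hρ]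
    have e1 : ρ - σ₀ = -W := by rw [hW]; abel
    have e2 : (W * W).trace = (((W * W).trace.re : ℝ) : ℂ) :=
      Complex.ext (by simp) (by simpa using trace_herm_im hWh hWh)
    rw [e1, Matrix.mul_neg, trace_neg, smul_eq_mul]
    conv_lhs => rw [e2]
    push_cast
    ring
  · intro σ hσ
    have hσd := hC_density σ hσ
    have e : (1 / 4 : ℂ) * (((t : ℂ) • H) * σ).trace
        = ((t / 4 : ℝ) : ℂ) * (W * (σ - σ₀)).trace := by
      rw [Matrix.smul_mul, trace_smul, hHtr σ hσd, smul_eq_mul]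
      push_cast
      ring
    rw [htr, e, Complex.im_ofReal_mul, Complex.re_ofReal_mul,
      trace_herm_im hWh ((density_herm hσd).sub hσ₀h)]
    exact ⟨by simp, mul_nonneg (by positivity) (hvar σ hσ)⟩
end

section
/- Let 1/2 < p < 1, set ψ₁ = (e₀ − e₁)/√2 and ψ₂ = √(1−p) e₀ + √p e₁ in ℂ², and let c = 2/(√(p(1−p)) + p − 1). Then c > 0 and, as 2×2 complex matrices, −|0⟩⟨0| = c · |0⟩⟨0| · |ψ₁⟩⟨ψ₁| · |ψ₂⟩⟨ψ₂| · |0⟩⟨0|; that is, the negative multiple of the projector |0⟩⟨0| is a positive multiple of an ordered product of rank-one projections. -/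
open Matrix

/-- for `1/2 < p < 1`, with `ψ₁ = (e₀ − e₁)/√2`,
`ψ₂ = √(1−p) e₀ + √p e₁` and `c = 2/(√(p(1−p)) + p − 1)`, one has `c > 0` and
`−|0⟩⟨0| = c · |0⟩⟨0| |ψ₁⟩⟨ψ₁| |ψ₂⟩⟨ψ₂| |0⟩⟨0|` as 2×2 complex matrices. -/
theorem negative_projector_as_product_of_projections
    (p : ℝ) (hp0 : 1 / 2 < p) (hp1 : p < 1)
    (ψ₁ ψ₂ : Fin 2 → ℂ)
    (hψ₁ : ψ₁ = ((Real.sqrt 2 : ℂ))⁻¹ • (e₀ - e₁))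
    (hψ₂ : ψ₂ = (Real.sqrt (1 - p) : ℂ) • e₀ + (Real.sqrt p : ℂ) • e₁)
    (c : ℝ) (hc : c = 2 / (Real.sqrt (p * (1 - p)) + p - 1)) :
    0 < c ∧
      -outer e₀ e₀
        = (c : ℂ) • (outer e₀ e₀ * outer ψ₁ ψ₁ * outer ψ₂ ψ₂ * outer e₀ e₀) := by
  have hp : 0 ≤ p := by linarith
  have hq : 0 < 1 - p := by linarith
  have hs2 : (Real.sqrt 2) ^ 2 = 2 := Real.sq_sqrt (by norm_num)
  have hs2' : ((Real.sqrt 2 : ℝ) : ℂ) ^ 2 = 2 := by exact_mod_cast hs2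
  have hs0 : ((Real.sqrt 2 : ℝ) : ℂ) ≠ 0 := by
    intro h
    rw [h] at hs2'
    norm_num at hs2'
  have ha : 0 < Real.sqrt (1 - p) := Real.sqrt_pos.mpr hq
  have hab : Real.sqrt (1 - p) < Real.sqrt p := Real.sqrt_lt_sqrt hq.le (by linarith)
  have hasq : Real.sqrt (1 - p) ^ 2 = 1 - p := Real.sq_sqrt hq.le
  rw [Real.sqrt_mul hp] at hc
  generalize Real.sqrt (1 - p) = a at *
  generalize Real.sqrt p = b at *
  have hden : b * a + p - 1 = a * (b - a) := by linear_combination hasq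
  rw [hden] at hc
  have hpos : 0 < a * (b - a) := mul_pos ha (by linarith)
  have hca : c * (a * (b - a)) = 2 := by
    rw [hc]
    exact div_mul_cancel₀ _ hpos.ne'
  have hcaC : (c : ℂ) * (a * (b - a)) = 2 := by exact_mod_cast hca
  have hinv : (((Real.sqrt 2 : ℝ) : ℂ)⁻¹) ^ 2 = 1 / 2 := by
    rw [inv_pow, hs2']
    norm_num
  refine ⟨by rw [hc]; positivity, ?_⟩
  subst hψ₁ hψ₂
  ext i j
  simp only [outer, Matrix.neg_apply, Matrix.smul_apply, Matrix.mul_apply,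
    Matrix.vecMulVec_apply, Fin.sum_univ_two, Pi.star_apply, Pi.add_apply, Pi.sub_apply,
    Pi.smul_apply, smul_eq_mul]
  fin_cases i <;> fin_cases j <;> simp [e₀, e₁]
  linear_combination (1 / 2 : ℂ) * hcaC - (c : ℂ) * (a * (a - b)) * hinv
end

section
/- Let k ∈ ℂ^n be a unit vector, b > 0, 1/2 < p < 1, and let ρ be a density matrix on ℂ^n with ⟨k, ρk⟩ > 0. Set ψ₁ = (e₀ − e₁)/√2, ψ₂ = √(1−p) e₀ + √p e₁, c = 2/(√(p(1−p)) + p − 1), π₁ = |k⟩⟨k|⊗|ψ₁⟩⟨ψ₁|, π₂ = |k⟩⟨k|⊗|ψ₂⟩⟨ψ₂|, and d = b c · Tr[π₁ (ρ⊗|0⟩⟨0|)]. Then d > 0, the weak value WV = Tr[π₁ π₂ (ρ⊗|0⟩⟨0|)] / Tr[π₁ (ρ⊗|0⟩⟨0|)] is a well-defined real number equal to 1 − p − √(p(1−p)) < 0, and Tr[(−b |k⟩⟨k|⊗|0⟩⟨0|) (ρ⊗|0⟩⟨0|)] = d · WV. In particular, the weak value of the projector π₂ is strictly negative and hence anomalous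 (its real part lies below 0, the smallest eigenvalue of π₂). -/
open Matrix Kronecker ComplexOrder

lemma trace_outer_mul {n : Type*} [Fintype n] (u v : n → ℂ) (M : Matrix n n ℂ) :
    (outer u v * M).trace = star v ⬝ᵥ M.mulVec u := by
  unfold outer
  rw [Matrix.vecMulVec_mul, Matrix.trace_vecMulVec, dotProduct_comm, Matrix.dotProduct_mulVec]

lemma outer_self_mul {n : Type*} [Fintype n] (k : n → ℂ) (hk : star k ⬝ᵥ k = 1) :
    outer k k * outer k k = outer k k := by
  unfold outer
  rw [Matrix.vecMulVec_mul_vecMulVec, hk]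
  simp

/-- the expectation of the negative witness part `−b|k⟩⟨k|⊗|0⟩⟨0|` is a
positive multiple `d` of the weak value of the projector `π₂ = |k⟩⟨k|⊗|ψ₂⟩⟨ψ₂|` with
post-selection `π₁ = |k⟩⟨k|⊗|ψ₁⟩⟨ψ₁|` and pre-selection `ρ⊗|0⟩⟨0|`; the weak value equals
`1 − p − √(p(1−p)) < 0`, so it is strictly negative and hence anomalous. -/
theorem negative_witness_part_as_anomalous_weak_value
    (n : ℕ) (k : Fin n → ℂ) (hk : star k ⬝ᵥ k = 1)
    (b : ℝ) (hb : 0 < b) (p : ℝ) (hp0 : 1 / 2 < p) (hp1 : p < 1)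
    (ρ : Matrix (Fin n) (Fin n) ℂ) (hρ : IsDensityMatrix ρ)
    (hkρ : 0 < (star k ⬝ᵥ ρ.mulVec k).re)
    (ψ₁ ψ₂ : Fin 2 → ℂ)
    (hψ₁ : ψ₁ = ((Real.sqrt 2 : ℂ))⁻¹ • (e₀ - e₁))
    (hψ₂ : ψ₂ = (Real.sqrt (1 - p) : ℂ) • e₀ + (Real.sqrt p : ℂ) • e₁)
    (c : ℝ) (hc : c = 2 / (Real.sqrt (p * (1 - p)) + p - 1))
    (π₁ π₂ : Matrix (Fin n × Fin 2) (Fin n × Fin 2) ℂ)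
    (hπ₁ : π₁ = outer k k ⊗ₖ outer ψ₁ ψ₁) (hπ₂ : π₂ = outer k k ⊗ₖ outer ψ₂ ψ₂)
    (d : ℝ) (hd : d = b * c * ((π₁ * (ρ ⊗ₖ outer e₀ e₀)).trace).re) :
    0 < d ∧
      (π₁ * (ρ ⊗ₖ outer e₀ e₀)).trace ≠ 0 ∧
      (π₁ * π₂ * (ρ ⊗ₖ outer e₀ e₀)).trace / (π₁ * (ρ ⊗ₖ outer e₀ e₀)).trace
        = ((1 - p - Real.sqrt (p * (1 - p)) : ℝ) : ℂ) ∧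
      (1 - p - Real.sqrt (p * (1 - p)) : ℝ) < 0 ∧
      (((-(b : ℂ)) • (outer k k ⊗ₖ outer e₀ e₀)) * (ρ ⊗ₖ outer e₀ e₀)).trace
        = (d : ℂ) *
          ((π₁ * π₂ * (ρ ⊗ₖ outer e₀ e₀)).trace / (π₁ * (ρ ⊗ₖ outer e₀ e₀)).trace) := by
  have hq : 0 < 1 - p := by linarith
  have hp : 0 < p := by linarith
  have hneg : (1 - p - Real.sqrt (p * (1 - p)) : ℝ) < 0 := by
    have : 1 - p < Real.sqrt (p * (1 - p)) := by
      apply Real.lt_sqrt_of_sq_lt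
      nlinarith
    linarith
  obtain ⟨t, ht⟩ : ∃ t : ℝ, star k ⬝ᵥ ρ.mulVec k = (t : ℂ) := by
    have h0 := hρ.1.dotProduct_mulVec_nonneg k
    refine ⟨(star k ⬝ᵥ ρ.mulVec k).re, ?_⟩
    have h1 := (Complex.le_def.1 h0).2
    apply Complex.ext <;> simp_all
  have htpos : 0 < t := by simpa [ht] using hkρ
  have hs2 : ((Real.sqrt 2 : ℂ))⁻¹ * ((Real.sqrt 2 : ℂ))⁻¹ = 1 / 2 := by
    rw [← mul_inv, ← Complex.ofReal_mul, Real.mul_self_sqrt (by norm_num)]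
    norm_num
  have hqq : (Real.sqrt (1 - p) : ℂ) * (Real.sqrt (1 - p) : ℂ) = 1 - p := by
    rw [← Complex.ofReal_mul, Real.mul_self_sqrt hq.le]
    push_cast; ring
  have hpq : (Real.sqrt (p * (1 - p)) : ℂ) = (Real.sqrt p : ℂ) * (Real.sqrt (1 - p) : ℂ) := by
    rw [← Complex.ofReal_mul, Real.sqrt_mul hp.le]
  have hA : (π₁ * (ρ ⊗ₖ outer e₀ e₀)).trace = (t : ℂ) / 2 := by
    rw [hπ₁, ← Matrix.mul_kronecker_mul, Matrix.trace_kronecker, trace_outer_mul, ht]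
    have : (outer ψ₁ ψ₁ * outer e₀ e₀).trace = 1 / 2 := by
      rw [← hs2, hψ₁]
      simp only [outer, Matrix.trace_fin_two, Matrix.mul_apply, Matrix.vecMulVec_apply,
        Fin.sum_univ_two]
      simp [e₀, e₁]
    rw [this]; ring
  have hB : (π₁ * π₂ * (ρ ⊗ₖ outer e₀ e₀)).trace
      = (t : ℂ) / 2 * ((1 - p - Real.sqrt (p * (1 - p)) : ℝ) : ℂ) := by
    rw [hπ₁, hπ₂, ← Matrix.mul_kronecker_mul, ← Matrix.mul_kronecker_mul, outer_self_mul k hk,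
      Matrix.trace_kronecker, trace_outer_mul, ht]
    have : (outer ψ₁ ψ₁ * outer ψ₂ ψ₂ * outer e₀ e₀).trace
        = 1 / 2 * (1 - p - (Real.sqrt (p * (1 - p)) : ℂ)) := by
      rw [hpq, ← hqq, ← hs2, hψ₁, hψ₂]
      simp only [outer, Matrix.trace_fin_two, Matrix.mul_apply, Matrix.vecMulVec_apply,
        Fin.sum_univ_two]
      simp [e₀, e₁]
      ring
    rw [this]; push_cast; ring
  have hC : (((-(b : ℂ)) • (outer k k ⊗ₖ outer e₀ e₀)) * (ρ ⊗ₖ outer e₀ e₀)).trace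
      = -(b : ℂ) * t := by
    rw [Matrix.smul_mul, Matrix.trace_smul, ← Matrix.mul_kronecker_mul, Matrix.trace_kronecker,
      trace_outer_mul, ht]
    have : (outer e₀ e₀ * outer e₀ e₀).trace = 1 := by
      simp only [outer, Matrix.trace_fin_two, Matrix.mul_apply, Matrix.vecMulVec_apply,
        Fin.sum_univ_two]
      simp [e₀]
    rw [this]; simp
  have htc : (t : ℂ) / 2 ≠ 0 := by
    have : (t : ℂ) ≠ 0 := by exact_mod_cast htpos.ne'
    simpa using this
  have hre : ((t : ℂ) / 2).re = t / 2 := by simp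
  have hW : (π₁ * π₂ * (ρ ⊗ₖ outer e₀ e₀)).trace / (π₁ * (ρ ⊗ₖ outer e₀ e₀)).trace
        = ((1 - p - Real.sqrt (p * (1 - p)) : ℝ) : ℂ) := by
    rw [hA, hB, mul_div_cancel_left₀ _ htc]
  have hden : 0 < Real.sqrt (p * (1 - p)) + p - 1 := by linarith
  have hd' : d = b * c * (t / 2) := by rw [hd, hA, hre]
  refine ⟨?_, by rw [hA]; exact htc, hW, hneg, ?_⟩
  · rw [hd', hc]; positivity
  · rw [hC, hW, ← Complex.ofReal_neg, ← Complex.ofReal_mul, ← Complex.ofReal_mul, hd', hc]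
    congr 1
    have := hden.ne'
    field_simp
    ring
end

section
/- Let k₊, k₋ be orthonormal vectors in ℂ^n, a, b > 0, and W = a|k₊⟩⟨k₊| − b|k₋⟩⟨k₋|. Let 1/2 < p < 1, ψ₁ = (e₀ − e₁)/√2, ψ₂ = √(1−p) e₀ + √p e₁. Let ρ be a density matrix on ℂ^n with ⟨k₊, ρk₊⟩ > 0 and ⟨k₋, ρk₋⟩ > 0. Define the projectors π₁(0) = π₂(0) = |k₊⟩⟨k₊|⊗|0⟩⟨0|, π₁(1) = |k₋⟩⟨k₋|⊗|ψ₁⟩⟨ψ₁|, π₂(1) = |k₋⟩⟨k₋|⊗|ψ₂⟩⟨ψ₂|, and the weak values WV_j = Tr[π₁(j) π₂(j) (ρ⊗|0⟩⟨0|)]/Tr[π₁(j) (ρ⊗|0⟩⟨0|)] for j = 0, 1. Then there exist real numbers k₀, k₁ ≥ 0 such that Tr[Wρ] = k₀·WV₀ + k₁·WV₁; moreover WV₀ = 1, WV₁ = 1 − p − √(p(1−p)) < 0, and if Tr[Wρ] < 0 then the weak value WV₁ of the projector π₂(1) is strictly negative and hence anomalous. -/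
open Matrix Kronecker ComplexOrder

theorem outer_mul_self_aux {n : ℕ} (k : Fin n → ℂ) (hk : star k ⬝ᵥ k = 1) :
    outer k k * outer k k = outer k k := by
  unfold outer
  rw [Matrix.vecMulVec_mul_vecMulVec, hk]
  simp

theorem trace_outer_mul_aux {n : ℕ} (k : Fin n → ℂ) (ρ : Matrix (Fin n) (Fin n) ℂ) :
    (outer k k * ρ).trace = star k ⬝ᵥ ρ.mulVec k := by
  unfold outer
  rw [Matrix.vecMulVec_mul, Matrix.trace_vecMulVec, dotProduct_comm, Matrix.dotProduct_mulVec]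

theorem quad_real_aux {n : ℕ} (k : Fin n → ℂ) (ρ : Matrix (Fin n) (Fin n) ℂ)
    (hρ : ρ.PosSemidef) :
    star k ⬝ᵥ ρ.mulVec k = ((star k ⬝ᵥ ρ.mulVec k).re : ℂ) := by
  have h := hρ.dotProduct_mulVec_nonneg k
  rw [Complex.le_def] at h
  apply Complex.ext
  · simp
  · simpa using h.2.symm

/-- two-eigenvalue case of the paper's Theorem 2: the expectation of the
rank-two witness `W = a|k₊⟩⟨k₊| − b|k₋⟩⟨k₋|` is a conical combination
`Tr[Wρ] = k₀·WV₀ + k₁·WV₁` of weak values; `WV₀ = 1`, `WV₁ = 1 − p − √(p(1−p)) < 0`, and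
if `Tr[Wρ] < 0` then the weak value `WV₁` of the projector `π₂(1)` is strictly negative,
hence anomalous. -/
theorem witness_expectation_as_conical_combination_of_weak_values
    (n : ℕ) (kp km : Fin n → ℂ)
    (hkp : star kp ⬝ᵥ kp = 1) (hkm : star km ⬝ᵥ km = 1) (hortho : star kp ⬝ᵥ km = 0)
    (a b : ℝ) (ha : 0 < a) (hb : 0 < b)
    (W : Matrix (Fin n) (Fin n) ℂ)
    (hW : W = (a : ℂ) • outer kp kp - (b : ℂ) • outer km km)
    (p : ℝ) (hp0 : 1 / 2 < p) (hp1 : p < 1)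
    (ψ₁ ψ₂ : Fin 2 → ℂ)
    (hψ₁ : ψ₁ = ((Real.sqrt 2 : ℂ))⁻¹ • (e₀ - e₁))
    (hψ₂ : ψ₂ = (Real.sqrt (1 - p) : ℂ) • e₀ + (Real.sqrt p : ℂ) • e₁)
    (ρ : Matrix (Fin n) (Fin n) ℂ) (hρ : IsDensityMatrix ρ)
    (hkpρ : 0 < (star kp ⬝ᵥ ρ.mulVec kp).re) (hkmρ : 0 < (star km ⬝ᵥ ρ.mulVec km).re)
    (π₁0 π₂0 π₁1 π₂1 : Matrix (Fin n × Fin 2) (Fin n × Fin 2) ℂ)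
    (hπ₁0 : π₁0 = outer kp kp ⊗ₖ outer e₀ e₀) (hπ₂0 : π₂0 = outer kp kp ⊗ₖ outer e₀ e₀)
    (hπ₁1 : π₁1 = outer km km ⊗ₖ outer ψ₁ ψ₁) (hπ₂1 : π₂1 = outer km km ⊗ₖ outer ψ₂ ψ₂)
    (WV₀ WV₁ : ℂ)
    (hWV₀ : WV₀ = (π₁0 * π₂0 * (ρ ⊗ₖ outer e₀ e₀)).trace / (π₁0 * (ρ ⊗ₖ outer e₀ e₀)).trace)
    (hWV₁ : WV₁ = (π₁1 * π₂1 * (ρ ⊗ₖ outer e₀ e₀)).trace / (π₁1 * (ρ ⊗ₖ outer e₀ e₀)).trace) :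
    (∃ k₀ k₁ : ℝ, 0 ≤ k₀ ∧ 0 ≤ k₁ ∧
        (W * ρ).trace = (k₀ : ℂ) * WV₀ + (k₁ : ℂ) * WV₁) ∧
      WV₀ = 1 ∧
      WV₁ = ((1 - p - Real.sqrt (p * (1 - p)) : ℝ) : ℂ) ∧
      (1 - p - Real.sqrt (p * (1 - p)) : ℝ) < 0 ∧
      ((W * ρ).trace.re < 0 → WV₁.re < 0) := by
  obtain ⟨hps, -⟩ := hρ
  have rp := quad_real_aux kp ρ hps
  have rm := quad_real_aux km ρ hps
  have tp := trace_outer_mul_aux kp ρ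
  have tm := trace_outer_mul_aux km ρ
  rw [rp] at tp
  rw [rm] at tm
  generalize (star kp ⬝ᵥ ρ.mulVec kp).re = x at *
  generalize (star km ⬝ᵥ ρ.mulVec km).re = y at *
  have hx : (x : ℂ) ≠ 0 := by exact_mod_cast hkpρ.ne'
  have hy : (y : ℂ) ≠ 0 := by exact_mod_cast hkmρ.ne'
  have q0 : (outer e₀ e₀ * outer e₀ e₀).trace = 1 := by
    simp only [outer, Matrix.trace_fin_two, Matrix.mul_apply, Matrix.vecMulVec_apply,
      Fin.sum_univ_two]
    simp [e₀]
  have q00 : (outer e₀ e₀ * outer e₀ e₀ * outer e₀ e₀).trace = 1 := by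
    simp only [outer, Matrix.trace_fin_two, Matrix.mul_apply, Matrix.vecMulVec_apply,
      Fin.sum_univ_two]
    simp [e₀]
  have h2 : ((Real.sqrt 2 : ℂ))⁻¹ * ((Real.sqrt 2 : ℂ))⁻¹ = 1 / 2 := by
    rw [← mul_inv, ← Complex.ofReal_mul, Real.mul_self_sqrt (by norm_num)]
    norm_num
  have hs : (Real.sqrt (1 - p) : ℂ) * (Real.sqrt (1 - p) : ℂ) = 1 - p := by
    rw [← Complex.ofReal_mul, Real.mul_self_sqrt (by linarith)]
    push_cast; rfl
  have hsp : (Real.sqrt (p * (1 - p)) : ℂ) = Real.sqrt p * Real.sqrt (1 - p) := by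
    rw [Real.sqrt_mul (by linarith)]
    push_cast; rfl
  have q1 : (outer ψ₁ ψ₁ * outer e₀ e₀).trace = 1 / 2 := by
    subst hψ₁
    simp only [outer, Matrix.trace_fin_two, Matrix.mul_apply, Matrix.vecMulVec_apply,
      Fin.sum_univ_two]
    simp [e₀, e₁]
    linear_combination h2
  have q2 : (outer ψ₁ ψ₁ * outer ψ₂ ψ₂ * outer e₀ e₀).trace
      = 1 / 2 * (1 - p - Real.sqrt (p * (1 - p))) := by
    subst hψ₁ hψ₂
    rw [hsp]
    simp only [outer, Matrix.trace_fin_two, Matrix.mul_apply, Matrix.vecMulVec_apply,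
      Fin.sum_univ_two]
    simp [e₀, e₁]
    linear_combination (1 - p - (Real.sqrt p : ℂ) * Real.sqrt (1 - p)) * h2
      + ((Real.sqrt 2 : ℂ))⁻¹ * ((Real.sqrt 2 : ℂ))⁻¹ * hs
  have e0 : WV₀ = 1 := by
    rw [hWV₀, hπ₁0, hπ₂0]
    simp only [← Matrix.mul_kronecker_mul, Matrix.trace_kronecker, outer_mul_self_aux kp hkp,
      tp, q0, q00]
    field_simp
  have e1 : WV₁ = ((1 - p - Real.sqrt (p * (1 - p)) : ℝ) : ℂ) := by
    rw [hWV₁, hπ₁1, hπ₂1]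
    simp only [← Matrix.mul_kronecker_mul, Matrix.trace_kronecker, outer_mul_self_aux km hkm,
      tm, q1, q2]
    push_cast
    field_simp
  have hneg : (1 - p - Real.sqrt (p * (1 - p)) : ℝ) < 0 := by
    have : 1 - p < Real.sqrt (p * (1 - p)) := by
      apply Real.lt_sqrt_of_sq_lt
      nlinarith
    linarith
  refine ⟨⟨a * x, b * y / -(1 - p - Real.sqrt (p * (1 - p))), by positivity, ?_, ?_⟩,
    e0, e1, hneg, fun _ => ?_⟩
  · exact div_nonneg (by positivity) (by linarith)
  · rw [e0, e1, hW, Matrix.sub_mul, Matrix.trace_sub, Matrix.smul_mul, Matrix.smul_mul,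
      Matrix.trace_smul, Matrix.trace_smul, tp, tm]
    generalize (1 - p - Real.sqrt (p * (1 - p)) : ℝ) = w at *
    have hw : (w : ℂ) ≠ 0 := by exact_mod_cast hneg.ne
    push_cast
    simp only [smul_eq_mul]
    field_simp
    ring
  · rw [e1, Complex.ofReal_re]
    exact hneg
end
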